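/- arXiv:1108.1585 — 8 statements merged into one kernel-verified Lean document; each statement's English description precedes it below -/
import Mathlib

section
/- Let x¹ = q¹ − (Θ/2ħ)π², x² = q² + (Θ/2ħ)π¹, p¹ = π¹ + (Θ̄/2ħ)q², p² = π² − (Θ̄/2ħ)q¹, and let ħ_eff = ħ(1 + ΘΘ̄/(4ħ²)). Then [x^μ, p^ν] = i ħ_eff δ^{μν}·1 for all μ,ν ∈ {1,2}; in particular [x¹, p¹] = [x², p²] = iħ_eff·1 and [x¹, p²] = [x², p¹] = 0. -/
/-- With x¹ = q¹ − (Θ/2ℏ)π², x² = q² + (Θ/2ℏ)π¹,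
p¹ = π¹ + (Θ̄/2ℏ)q², p² = π² − (Θ̄/2ℏ)q¹ and ℏ_eff = ℏ(1 + ΘΘ̄/(4ℏ²)),
one has [xᵘ, pᵛ] = i ℏ_eff δᵘᵛ · 1 for μ,ν ∈ {1,2}. -/
theorem commutator_x_p {A : Type*} [Ring A] [Algebra ℂ A]
    (ℏ Θ Θbar : ℝ) (hℏ : 0 < ℏ)
    (q1 q2 π1 π2 : A)
    (h11 : q1 * π1 - π1 * q1 = (Complex.I * (ℏ : ℂ)) • (1 : A))
    (h22 : q2 * π2 - π2 * q2 = (Complex.I * (ℏ : ℂ)) • (1 : A))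
    (h12 : q1 * π2 - π2 * q1 = 0)
    (h21 : q2 * π1 - π1 * q2 = 0)
    (hqq : q1 * q2 - q2 * q1 = 0)
    (hππ : π1 * π2 - π2 * π1 = 0) :
    letI x1 : A := q1 - ((Θ / (2 * ℏ) : ℝ) : ℂ) • π2
    letI x2 : A := q2 + ((Θ / (2 * ℏ) : ℝ) : ℂ) • π1
    letI p1 : A := π1 + ((Θbar / (2 * ℏ) : ℝ) : ℂ) • q2
    letI p2 : A := π2 - ((Θbar / (2 * ℏ) : ℝ) : ℂ) • q1
    letI ℏeff : ℝ := ℏ * (1 + Θ * Θbar / (4 * ℏ ^ 2))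
    (x1 * p1 - p1 * x1 = (Complex.I * (ℏeff : ℂ)) • (1 : A)) ∧
    (x2 * p2 - p2 * x2 = (Complex.I * (ℏeff : ℂ)) • (1 : A)) ∧
    (x1 * p2 - p2 * x1 = 0) ∧
    (x2 * p1 - p1 * x2 = 0) := by
  have hscalar : Complex.I * ((ℏ * (1 + Θ * Θbar / (4 * ℏ ^ 2)) : ℝ) : ℂ) =
      Complex.I * ℏ +
        ((Θ / (2 * ℏ) : ℝ) : ℂ) * ((Θbar / (2 * ℏ) : ℝ) : ℂ) * (Complex.I * ℏ) := by
    have hne : (ℏ : ℂ) ≠ 0 := by exact_mod_cast hℏ.ne'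
    push_cast
    field_simp
    ring
  simp only [hscalar]
  generalize ((Θ / (2 * ℏ) : ℝ) : ℂ) = a
  generalize ((Θbar / (2 * ℏ) : ℝ) : ℂ) = b
  simp only [mul_add, add_mul, mul_sub, sub_mul, smul_mul_assoc, mul_smul_comm]
  refine ⟨?_, ?_, ?_, ?_⟩
  · linear_combination (norm := module) h11 + b • hqq + a • hππ + (a * b) • h22
  · linear_combination (norm := module) h22 + b • hqq + a • hππ + (a * b) • h11
  · linear_combination (norm := module) h12 - (a * b) • h12
  · linear_combination (norm := module) h21 - (a * b) • h21
end

section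
/- For all m, n ∈ ℕ with n ≥ m and m ≥ 1, the Moyal star product of the annihilation symbol a with the Wigner eigenfunction f_{m,n} satisfies a ⋆ f_{m,n} = √(mħ) f_{m−1,n}, where for the linear function a the star product is exactly a ⋆ f = a·f + (iħ/2)(∂_q a ∂_π f − ∂_π a ∂_q f). -/
open Complex Real

/-- Generalized Laguerre polynomial
`L_m^α(x) = Σ_{k=0}^{m} (Γ(m+α+1)/Γ(k+α+1)) (−x)^k/(k!(m−k)!)` (natural α). -/
noncomputable def genLaguerre (m α : ℕ) (x : ℝ) : ℝ :=
  ∑ k ∈ Finset.range (m + 1),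
    (Real.Gamma ((m : ℝ) + α + 1) / Real.Gamma ((k : ℝ) + α + 1)) * (-x) ^ k /
      ((k.factorial : ℝ) * ((m - k).factorial : ℝ))

/-- Wigner eigenfunction
`f_{m,n}(q,p) = 2(−1)^m √(m!/n!) (2/ℏ)^{(n−m)/2} (q+ip)^{n−m}
  L_m^{n−m}(2(q²+p²)/ℏ) e^{−(q²+p²)/ℏ}` (for n ≥ m). -/
noncomputable def wignerF (ℏ : ℝ) (m n : ℕ) (q p : ℝ) : ℂ :=
  2 * (-1) ^ m * (Real.sqrt ((m.factorial : ℝ) / (n.factorial : ℝ)) : ℂ) *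
    ((Real.sqrt (2 / ℏ) : ℂ)) ^ (n - m) * ((q : ℂ) + Complex.I * (p : ℂ)) ^ (n - m) *
    ((genLaguerre m (n - m) (2 * (q ^ 2 + p ^ 2) / ℏ) : ℝ) : ℂ) *
    (Real.exp (-(q ^ 2 + p ^ 2) / ℏ) : ℂ)

/-- `d/dx L_{m+1}^α = -L_m^{α+1}`. -/
theorem hasDerivAt_genLaguerre_succ (m α : ℕ) (x : ℝ) :
    HasDerivAt (genLaguerre (m + 1) α) (-genLaguerre m (α + 1) x) x := by
  have h : HasDerivAt (genLaguerre (m + 1) α)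
      (∑ k ∈ Finset.range (m + 1 + 1),
        (Real.Gamma (((m + 1 : ℕ) : ℝ) + α + 1) / Real.Gamma ((k : ℝ) + α + 1)) *
          ((k : ℝ) * (-x) ^ (k - 1) * (-1)) /
          ((k.factorial : ℝ) * ((m + 1 - k).factorial : ℝ))) x := by
    unfold genLaguerre
    exact HasDerivAt.fun_sum fun k _ =>
      ((((hasDerivAt_id x).neg).pow k).const_mul _).div_const _
  convert h using 1
  rw [Finset.sum_range_succ', genLaguerre, ← Finset.sum_neg_distrib]
  simp only [Nat.cast_zero, zero_mul, mul_zero, zero_div, add_zero]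
  refine Finset.sum_congr rfl fun k _ => ?_
  have hk : ((k : ℝ) + 1) ≠ 0 := by positivity
  have hf : (k.factorial : ℝ) ≠ 0 := by positivity
  have hd : ((m - k).factorial : ℝ) ≠ 0 := by positivity
  rw [Nat.add_sub_add_right, Nat.factorial_succ]
  push_cast [Nat.sub_zero]
  rw [show (m : ℝ) + (α + 1) + 1 = m + 1 + α + 1 by ring,
    show (k : ℝ) + (α + 1) + 1 = k + 1 + α + 1 by ring]
  field_simp

/-- Chain rule for `wignerF` along a real curve `(u, v)` with velocity `(u', v')`. -/
theorem hasDerivAt_wignerF_succ (ℏ : ℝ) (m n : ℕ) {u v : ℝ → ℝ} {u' v' t : ℝ}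
    (hu : HasDerivAt u u' t) (hv : HasDerivAt v v' t) :
    HasDerivAt (fun s => wignerF ℏ (m + 1) n (u s) (v s))
      (2 * (-1) ^ (m + 1) * (Real.sqrt (((m + 1).factorial : ℝ) / (n.factorial : ℝ)) : ℂ) *
        ((Real.sqrt (2 / ℏ) : ℂ)) ^ (n - (m + 1)) *
        (Real.exp (-(u t ^ 2 + v t ^ 2) / ℏ) : ℂ) *
        (((n - (m + 1) : ℕ) : ℂ) * ((u t : ℂ) + Complex.I * v t) ^ (n - (m + 1) - 1) *
            ((u' : ℂ) + Complex.I * v') *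
            (genLaguerre (m + 1) (n - (m + 1)) (2 * (u t ^ 2 + v t ^ 2) / ℏ) : ℂ) -
          ((u t : ℂ) + Complex.I * v t) ^ (n - (m + 1)) *
            (2 * (u t * u' + v t * v') / ℏ) *
            (2 * (genLaguerre m (n - (m + 1) + 1) (2 * (u t ^ 2 + v t ^ 2) / ℏ) : ℂ) +
              (genLaguerre (m + 1) (n - (m + 1)) (2 * (u t ^ 2 + v t ^ 2) / ℏ) : ℂ)))) t := by
  have hr : HasDerivAt (fun s => u s ^ 2 + v s ^ 2) (2 * (u t * u' + v t * v')) t := by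
    refine ((hu.fun_pow 2).fun_add (hv.fun_pow 2)).congr_deriv ?_
    push_cast
    ring
  have hL := ((hasDerivAt_genLaguerre_succ m (n - (m + 1))
    (2 * (u t ^ 2 + v t ^ 2) / ℏ)).comp t ((hr.const_mul 2).div_const ℏ)).ofReal_comp
  have hE := ((hr.fun_neg).div_const ℏ).exp.ofReal_comp
  have hz := (hu.ofReal_comp.fun_add (hv.ofReal_comp.const_mul Complex.I)).fun_pow (n - (m + 1))
  refine (((hz.const_mul (2 * (-1) ^ (m + 1) *
    (Real.sqrt (((m + 1).factorial : ℝ) / (n.factorial : ℝ)) : ℂ) *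
    ((Real.sqrt (2 / ℏ) : ℂ)) ^ (n - (m + 1)))).fun_mul hL).fun_mul hE).congr_deriv ?_
  simp only [Function.comp_apply]
  push_cast
  ring

/-- The normalization constants of `a ⋆ f_{m+1,n}` and `√((m+1)ℏ) f_{m,n}` agree. -/
theorem sqrt_two_mul_sqrt_factorial_succ_div {ℏ : ℝ} (hℏ : 0 < ℏ) (m n : ℕ) :
    √2 * √(((m + 1).factorial : ℝ) / n.factorial) =
      √(((m + 1 : ℕ) : ℝ) * ℏ) * √((m.factorial : ℝ) / n.factorial) * √(2 / ℏ) := by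
  rw [← Real.sqrt_mul (by positivity), ← Real.sqrt_mul (by positivity),
    ← Real.sqrt_mul (by positivity), Nat.factorial_succ]
  congr 1
  push_cast
  field_simp

/-- for `n ≥ m ≥ 1`, the Moyal star product of the annihilation symbol
`a = (q+ip)/√2` with `f_{m,n}` (which for linear `a` is exactly
`a ⋆ f = a·f + (iℏ/2)(∂_q a ∂_p f − ∂_p a ∂_q f)`, with `∂_q a = 1/√2`, `∂_p a = i/√2`)
satisfies `a ⋆ f_{m,n} = √(mℏ) f_{m−1,n}`. -/
theorem annihilation_star_wigner (ℏ : ℝ) (hℏ : 0 < ℏ) (m n : ℕ) (hmn : m ≤ n)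
    (hm : 1 ≤ m) (q p : ℝ) :
    (((q : ℂ) + Complex.I * (p : ℂ)) / (Real.sqrt 2 : ℂ)) * wignerF ℏ m n q p
      + (Complex.I * (ℏ : ℂ) / 2) *
        ((1 / (Real.sqrt 2 : ℂ)) * deriv (fun t : ℝ => wignerF ℏ m n q t) p
          - (Complex.I / (Real.sqrt 2 : ℂ)) * deriv (fun t : ℝ => wignerF ℏ m n t p) q)
      = (Real.sqrt ((m : ℝ) * ℏ) : ℂ) * wignerF ℏ (m - 1) n q p := by
  obtain ⟨m, rfl⟩ : ∃ k, m = k + 1 := ⟨m - 1, by omega⟩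
  rw [(hasDerivAt_wignerF_succ ℏ m n (hasDerivAt_const p q) (hasDerivAt_id' p)).deriv,
    (hasDerivAt_wignerF_succ ℏ m n (hasDerivAt_id' q) (hasDerivAt_const q p)).deriv]
  have hα : n - m = n - (m + 1) + 1 := by omega
  have hc := congrArg (fun x : ℝ => (x : ℂ)) (sqrt_two_mul_sqrt_factorial_succ_div hℏ m n)
  have h2 : (√2 : ℂ) * √2 = 2 := by
    rw [← Complex.ofReal_mul, Real.mul_self_sqrt (by norm_num)]; norm_num
  have h2' : (√2 : ℂ) ≠ 0 := fun h => by simp [h] at h2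
  have hℏ' : (ℏ : ℂ) ≠ 0 := by exact_mod_cast hℏ.ne'
  simp only [wignerF, Nat.add_sub_cancel, hα]
  simp only [Complex.ofReal_mul] at hc
  generalize genLaguerre (m + 1) (n - (m + 1)) _ = L
  generalize genLaguerre m (n - (m + 1) + 1) _ = L'
  generalize Real.exp _ = E
  generalize n - (m + 1) = α at *
  generalize √(((m + 1).factorial : ℝ) / n.factorial) = A at *
  generalize √((m.factorial : ℝ) / n.factorial) = B at *
  generalize √(((m + 1 : ℕ) : ℝ) * ℏ) = D at *
  generalize √(2 / ℏ) = S at *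
  generalize (q + Complex.I * p : ℂ) ^ (α - 1) = w
  generalize hZ : (q + Complex.I * p : ℂ) ^ α = Z
  have hr : (√2 : ℂ)⁻¹ = √2 / 2 := by field_simp; rw [sq, h2]
  trans (√2 * A) * (2 * (-1) ^ m * (S : ℂ) ^ α * (Z * (q + Complex.I * p)) * L' * E)
  · simp only [div_eq_mul_inv _ (√2 : ℂ), hr]
    push_cast
    field_simp
    linear_combination (-2 * (-1) ^ m * A * S ^ α * E * Z * q * (2 * L' + L)) * Complex.I_sq
  · rw [hc, ← hZ]
    ring
end

section
/- For all m, n ∈ ℕ with n ≥ m + 1, the Moyal star product of the creation symbol ā with the Wigner eigenfunction f_{m,n} satisfies ā ⋆ f_{m,n} = √((m+1)ħ) f_{m+1,n}, where for the linear function ā the star product is exactly ā ⋆ f = ā·f + (iħ/2)(∂_q ā ∂_π f − ∂_π ā ∂_q f). -/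
open Complex Real

/-- With integer index the Gamma quotients in the coefficients are quotients of factorials. -/
theorem genLaguerre_eq_sum_factorial (m α : ℕ) (x : ℝ) :
    genLaguerre m α x = ∑ k ∈ Finset.range (m + 1),
      ((m + α).factorial : ℝ) / ((k + α).factorial * (k.factorial * (m - k).factorial)) *
        (-x) ^ k := by
  refine Finset.sum_congr rfl fun k _ => ?_
  have h (j : ℕ) : Real.Gamma ((j : ℝ) + α + 1) = (j + α).factorial := by
    rw [← Real.Gamma_nat_eq_factorial]; push_cast; rfl
  rw [h, h]
  field_simp

/-- The derivative relation `x L_m^{α+1}' + (α + 1 - x) L_m^{α+1} = (m + 1) L_{m+1}^α`. -/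
theorem exists_hasDerivAt_genLaguerre (m α : ℕ) (x : ℝ) :
    ∃ L' : ℝ, HasDerivAt (genLaguerre m (α + 1)) L' x ∧
      x * L' + ((α : ℝ) + 1 - x) * genLaguerre m (α + 1) x
        = ((m : ℝ) + 1) * genLaguerre (m + 1) α x := by
  refine ⟨∑ k ∈ Finset.range (m + 1),
      ((m + (α + 1)).factorial : ℝ) /
        ((k + (α + 1)).factorial * (k.factorial * (m - k).factorial)) *
        (k * (-x) ^ (k - 1) * (-1)), ?_, ?_⟩
  · rw [show genLaguerre m (α + 1) = _ from funext (genLaguerre_eq_sum_factorial m (α + 1))]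
    exact HasDerivAt.fun_sum fun k _ => (((hasDerivAt_id x).neg).pow k).const_mul _
  · have hsplit : ((m : ℝ) + 1) * genLaguerre (m + 1) α x
        = (∑ k ∈ Finset.range (m + 2), ((m : ℝ) + 1 - k) * (((m + 1 + α).factorial : ℝ) /
            ((k + α).factorial * (k.factorial * (m + 1 - k).factorial)) * (-x) ^ k))
          + ∑ k ∈ Finset.range (m + 2), (k : ℝ) * (((m + 1 + α).factorial : ℝ) /
            ((k + α).factorial * (k.factorial * (m + 1 - k).factorial)) * (-x) ^ k) := by
      rw [genLaguerre_eq_sum_factorial, Finset.mul_sum, ← Finset.sum_add_distrib]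
      exact Finset.sum_congr rfl fun k _ => by ring
    rw [hsplit, Finset.sum_range_succ _ (m + 1), Finset.sum_range_succ' _ (m + 1),
      genLaguerre_eq_sum_factorial, Finset.mul_sum, Finset.mul_sum, ← Finset.sum_add_distrib]
    push_cast
    rw [sub_self, zero_mul, zero_mul, add_zero, add_zero, ← Finset.sum_add_distrib]
    refine Finset.sum_congr rfl fun k hk => ?_
    obtain ⟨j, rfl⟩ := Nat.exists_eq_add_of_le (Nat.lt_succ_iff.mp (Finset.mem_range.mp hk))
    have hpow : x * ((k : ℝ) * (-x) ^ (k - 1) * (-1)) = k * (-x) ^ k := by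
      cases k with
      | zero => simp
      | succ i => rw [Nat.add_sub_cancel, pow_succ]; ring
    rw [mul_left_comm, hpow, show k + j + 1 - k = j + 1 by lia,
      show k + j - k = j by lia,
      show k + j + 1 + α = k + j + (α + 1) by lia, show k + 1 + α = k + α + 1 by lia,
      show k + (α + 1) = k + α + 1 by lia, Nat.factorial_succ (k + α), Nat.factorial_succ k,
      Nat.factorial_succ j]
    push_cast
    field_simp
    ring

/-- Derivative of `C w(t)^(d+1) L(x(t)) exp(-r(t)/ℏ)` along a real curve. -/
theorem hasDerivAt_wigner_profile {w : ℝ → ℂ} {r L : ℝ → ℝ} {w' : ℂ} {ℏ r' L' t : ℝ}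
    (C : ℂ) (d : ℕ) (hw : HasDerivAt w w' t) (hr : HasDerivAt r r' t)
    (hL : HasDerivAt L L' (2 * r t / ℏ)) :
    HasDerivAt (fun s => C * w s ^ (d + 1) * ((L (2 * r s / ℏ) : ℝ) : ℂ)
        * (Real.exp (-r s / ℏ) : ℂ))
      (C * w t ^ d * (Real.exp (-r t / ℏ) : ℂ) *
        (((d : ℂ) + 1) * w' * (L (2 * r t / ℏ) : ℂ)
          + w t * (r' / ℏ) * (2 * (L' : ℂ) - (L (2 * r t / ℏ) : ℂ)))) t := by
  have hx : HasDerivAt (fun s => 2 * r s / ℏ) (2 * r' / ℏ) t := (hr.const_mul 2).div_const ℏ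
  have hLx : HasDerivAt (fun s => L (2 * r s / ℏ)) (L' * (2 * r' / ℏ)) t :=
    HasDerivAt.comp t hL hx
  have he := (hr.neg.div_const ℏ).exp
  refine ((((hw.pow (d + 1)).const_mul C).mul hLx.ofReal_comp).mul he.ofReal_comp).congr_deriv ?_
  simp only [Pi.mul_apply, Pi.pow_apply, Pi.neg_apply, Nat.add_sub_cancel]
  push_cast
  ring

/-- for `n ≥ m+1`, the Moyal star product of the creation symbol
`ā = (q−ip)/√2` with `f_{m,n}` (which for linear `ā` is exactly
`ā ⋆ f = ā·f + (iℏ/2)(∂_q ā ∂_p f − ∂_p ā ∂_q f)`, with `∂_q ā = 1/√2`, `∂_p ā = −i/√2`)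
satisfies `ā ⋆ f_{m,n} = √((m+1)ℏ) f_{m+1,n}`. -/
theorem creation_star_wigner (ℏ : ℝ) (hℏ : 0 < ℏ) (m n : ℕ) (hmn : m + 1 ≤ n)
    (q p : ℝ) :
    (((q : ℂ) - Complex.I * (p : ℂ)) / (Real.sqrt 2 : ℂ)) * wignerF ℏ m n q p
      + (Complex.I * (ℏ : ℂ) / 2) *
        ((1 / (Real.sqrt 2 : ℂ)) * deriv (fun t : ℝ => wignerF ℏ m n q t) p
          - (-(Complex.I) / (Real.sqrt 2 : ℂ)) * deriv (fun t : ℝ => wignerF ℏ m n t p) q)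
      = (Real.sqrt (((m : ℝ) + 1) * ℏ) : ℂ) * wignerF ℏ (m + 1) n q p := by
  obtain ⟨d, rfl⟩ := Nat.exists_eq_add_of_le hmn
  have hd : m + 1 + d - m = d + 1 := by lia
  have hd' : m + 1 + d - (m + 1) = d := by lia
  obtain ⟨L', hL, hrel⟩ := exists_hasDerivAt_genLaguerre m d (2 * (q ^ 2 + p ^ 2) / ℏ)
  have hDp : HasDerivAt (fun t : ℝ => (q : ℂ) + Complex.I * (t : ℂ)) Complex.I p := by
    simpa using ((hasDerivAt_id p).ofReal_comp.const_mul Complex.I).const_add (q : ℂ)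
  have hDq : HasDerivAt (fun t : ℝ => (t : ℂ) + Complex.I * (p : ℂ)) 1 q := by
    simpa using (hasDerivAt_id q).ofReal_comp.add_const (Complex.I * (p : ℂ))
  have hrp : HasDerivAt (fun t : ℝ => q ^ 2 + t ^ 2) (2 * p) p := by
    simpa using (hasDerivAt_pow 2 p).const_add (q ^ 2)
  have hrq : HasDerivAt (fun t : ℝ => t ^ 2 + p ^ 2) (2 * q) q := by
    simpa using (hasDerivAt_pow 2 q).add_const (p ^ 2)
  unfold wignerF
  rw [hd, hd', (hasDerivAt_wigner_profile _ d hDp hrp hL).deriv,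
    (hasDerivAt_wigner_profile _ d hDq hrq hL).deriv]
  have hfac : √(((m : ℝ) + 1) * ℏ) * √(((m + 1).factorial : ℝ) / (m + 1 + d).factorial)
      = (m + 1) * √ℏ * √((m.factorial : ℝ) / (m + 1 + d).factorial) := by
    rw [Nat.factorial_succ, Nat.cast_mul, mul_div_assoc, Real.sqrt_mul (by positivity),
      Real.sqrt_mul (by positivity)]
    push_cast
    linear_combination √ℏ * √((m.factorial : ℝ) / (m + 1 + d).factorial) *
      Real.mul_self_sqrt (by positivity : (0 : ℝ) ≤ (m : ℝ) + 1)
  have hscale : √(2 / ℏ) * ℏ = √ℏ * √2 := by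
    rw [Real.sqrt_div zero_le_two]
    have := Real.sqrt_pos.mpr hℏ
    field_simp
    rw [Real.sq_sqrt hℏ.le]
  have h2 : (√2 : ℂ) ≠ 0 := by exact_mod_cast (Real.sqrt_pos.mpr zero_lt_two).ne'
  have hℏ0 : (ℏ : ℂ) ≠ 0 := by exact_mod_cast hℏ.ne'
  generalize genLaguerre m (d + 1) (2 * (q ^ 2 + p ^ 2) / ℏ) = L at *
  generalize genLaguerre (m + 1) d (2 * (q ^ 2 + p ^ 2) / ℏ) = M at *
  generalize √(((m + 1).factorial : ℝ) / (m + 1 + d).factorial) = F at *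
  generalize √((m.factorial : ℝ) / (m + 1 + d).factorial) = G at *
  generalize √(((m : ℝ) + 1) * ℏ) = S at *
  generalize √(2 / ℏ) = R at *
  generalize Real.exp (-(q ^ 2 + p ^ 2) / ℏ) = E
  have hrelC : 2 * ((q : ℂ) ^ 2 + p ^ 2) / ℏ * L'
      + ((d : ℂ) + 1 - 2 * (q ^ 2 + p ^ 2) / ℏ) * L = (m + 1) * M := by exact_mod_cast hrel
  have hfacC : (S : ℂ) * F = (m + 1) * √ℏ * G := by exact_mod_cast hfac
  have hscaleC : (R : ℂ) * ℏ = √ℏ * √2 := by exact_mod_cast hscale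
  generalize hz : (q : ℂ) + Complex.I * p = z
  have hzz : z * ((q : ℂ) - Complex.I * p) = q ^ 2 + p ^ 2 := by
    rw [← hz]; linear_combination -(p : ℂ) ^ 2 * Complex.I_sq
  calc
    _ = -(2 * (-1) ^ m * G * R ^ d * z ^ d * E) * (R * ℏ) / √2 *
        (2 * (z * ((q : ℂ) - Complex.I * p)) / ℏ * L'
          + ((d : ℂ) + 1 - 2 * (z * ((q : ℂ) - Complex.I * p)) / ℏ) * L) := by
      push_cast
      field_simp
      ring_nf
      simp only [Complex.I_sq]
      ring
    _ = -(2 * (-1) ^ m * R ^ d * z ^ d * E) * ((m + 1) * √ℏ * G) * M := by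
      rw [hzz, hrelC, hscaleC]
      field_simp
    _ = _ := by
      rw [← hfacC]
      ring
end

section
/- For all m, n ∈ ℕ with n ≥ m, the right Moyal star product of the Wigner eigenfunction f_{m,n} with the annihilation symbol a satisfies f_{m,n} ⋆ a = √((n+1)ħ) f_{m,n+1}, where for the linear function a the star product is exactly f ⋆ a = f·a + (iħ/2)(∂_q f ∂_π a − ∂_π f ∂_q a). -/
open Complex Real

/-- `d/dx L_m^α = L_m^α - L_m^{α+1}`. -/
lemma hasDerivAt_genLaguerre (m α : ℕ) (x : ℝ) :
    HasDerivAt (genLaguerre m α) (genLaguerre m α x - genLaguerre m (α + 1) x) x := by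
  have hsum : HasDerivAt (genLaguerre m α)
      (∑ k ∈ Finset.range (m + 1),
        (Real.Gamma ((m : ℝ) + α + 1) / Real.Gamma ((k : ℝ) + α + 1)) *
          ((k : ℝ) * (-x) ^ (k - 1) * (-1)) /
            ((k.factorial : ℝ) * ((m - k).factorial : ℝ))) x := by
    unfold genLaguerre
    refine HasDerivAt.fun_sum fun k _ => ?_
    exact (((hasDerivAt_id' x).neg.pow k).const_mul _).div_const _
  convert hsum using 1
  have hGamma (j β : ℕ) : Real.Gamma ((j : ℝ) + β + 1) = ((j + β).factorial : ℝ) := by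
    rw [← Real.Gamma_nat_eq_factorial]; push_cast; rfl
  simp only [genLaguerre, hGamma]
  rw [← Finset.sum_sub_distrib, Finset.sum_range_succ, Finset.sum_range_succ']
  have hlast (β : ℕ) : ((m + β).factorial : ℝ) / (m + β).factorial = 1 :=
    div_self (by positivity)
  simp only [hlast, sub_self, add_zero, Nat.cast_zero, zero_mul, mul_zero, zero_div]
  refine Finset.sum_congr rfl fun k hk => ?_
  obtain ⟨j, rfl⟩ : ∃ j, m = k + 1 + j :=
    Nat.exists_eq_add_of_le (Finset.mem_range.mp hk)
  rw [show k + 1 + j - k = j + 1 by omega, show k + 1 + j - (k + 1) = j by omega,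
    show k + 1 + j + (α + 1) = (k + 1 + j + α) + 1 by ring,
    show k + (α + 1) = (k + α) + 1 by ring, show k + 1 + α = (k + α) + 1 by ring]
  simp only [Nat.factorial_succ, Nat.add_sub_cancel]
  push_cast
  field_simp
  ring

/-- Chain rule for the functions `t ↦ C z(t)^k L_m^k(2 r(t)/ℏ) e^{-r(t)/ℏ}`. -/
lemma hasDerivAt_pow_mul_genLaguerre_mul_exp (ℏ : ℝ) (m k : ℕ) (C : ℂ) {z : ℝ → ℂ} {r : ℝ → ℝ}
    {z' : ℂ} {r' t : ℝ} (hz : HasDerivAt z z' t) (hr : HasDerivAt r r' t) :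
    HasDerivAt
      (fun s => C * z s ^ k * ((genLaguerre m k (2 * r s / ℏ) : ℝ) : ℂ) *
        (Real.exp (-r s / ℏ) : ℂ))
      (C * (k * z t ^ (k - 1) * z' * (genLaguerre m k (2 * r t / ℏ) : ℝ)
        + z t ^ k * (r' / ℏ) * ((genLaguerre m k (2 * r t / ℏ) : ℝ)
          - 2 * (genLaguerre m (k + 1) (2 * r t / ℏ) : ℝ))) * (Real.exp (-r t / ℏ) : ℂ)) t := by
  have hL := ((hasDerivAt_genLaguerre m k (2 * r t / ℏ)).comp t
    ((hr.const_mul 2).div_const ℏ)).ofReal_comp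
  have hE := ((hr.neg.div_const ℏ).exp).ofReal_comp
  refine ((((hz.pow k).const_mul C).mul hL).mul hE).congr_deriv ?_
  simp only [Function.comp_apply, Pi.pow_apply, Pi.mul_apply, Pi.neg_apply]
  push_cast
  ring

lemma sqrt_succ_mul_sqrt_factorial_div {ℏ : ℝ} (hℏ : 0 < ℏ) (m n : ℕ) :
    √(((n : ℝ) + 1) * ℏ) * √((m.factorial : ℝ) / ((n + 1).factorial : ℝ)) * √(2 / ℏ) =
      √2 * √((m.factorial : ℝ) / (n.factorial : ℝ)) := by
  rw [← Real.sqrt_mul (by positivity), ← Real.sqrt_mul (by positivity),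
    ← Real.sqrt_mul (by positivity), Nat.factorial_succ]
  congr 1
  push_cast
  field_simp

/-- for `n ≥ m`, the right Moyal star product of `f_{m,n}` with the
annihilation symbol `a = (q+ip)/√2` (which for linear `a` is exactly
`f ⋆ a = f·a + (iℏ/2)(∂_q f ∂_p a − ∂_p f ∂_q a)`, with `∂_q a = 1/√2`, `∂_p a = i/√2`)
satisfies `f_{m,n} ⋆ a = √((n+1)ℏ) f_{m,n+1}`. -/
theorem wigner_star_annihilation (ℏ : ℝ) (hℏ : 0 < ℏ) (m n : ℕ) (hmn : m ≤ n)
    (q p : ℝ) :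
    wignerF ℏ m n q p * (((q : ℂ) + Complex.I * (p : ℂ)) / (Real.sqrt 2 : ℂ))
      + (Complex.I * (ℏ : ℂ) / 2) *
        (deriv (fun t : ℝ => wignerF ℏ m n t p) q * (Complex.I / (Real.sqrt 2 : ℂ))
          - deriv (fun t : ℝ => wignerF ℏ m n q t) p * (1 / (Real.sqrt 2 : ℂ)))
      = (Real.sqrt (((n : ℝ) + 1) * ℏ) : ℂ) * wignerF ℏ m (n + 1) q p := by
  have hzq : HasDerivAt (fun t : ℝ => (t : ℂ) + Complex.I * (p : ℂ)) 1 q :=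
    (hasDerivAt_id' q).ofReal_comp.add_const _
  have hzp : HasDerivAt (fun t : ℝ => (q : ℂ) + Complex.I * (t : ℂ)) Complex.I p := by
    simpa using ((hasDerivAt_id' p).ofReal_comp.const_mul Complex.I).const_add (q : ℂ)
  have hrq : HasDerivAt (fun t : ℝ => t ^ 2 + p ^ 2) (2 * q) q := by
    simpa using (hasDerivAt_pow 2 q).add_const (p ^ 2)
  have hrp : HasDerivAt (fun t : ℝ => q ^ 2 + t ^ 2) (2 * p) p := by
    simpa using (hasDerivAt_pow 2 p).const_add (q ^ 2)
  have hconst : (√(((n : ℝ) + 1) * ℏ) : ℂ) *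
      (√((m.factorial : ℝ) / ((n + 1).factorial : ℝ)) : ℂ) * (√(2 / ℏ) : ℂ) =
      (√2 : ℂ) * (√((m.factorial : ℝ) / (n.factorial : ℝ)) : ℂ) := by
    exact_mod_cast sqrt_succ_mul_sqrt_factorial_div hℏ m n
  have hsq : (√2 : ℂ) ^ 2 = 2 := by
    exact_mod_cast Real.sq_sqrt (zero_le_two (α := ℝ))
  have hsqrt2 : (√2 : ℂ) ≠ 0 := by
    exact_mod_cast (Real.sqrt_pos.mpr zero_lt_two).ne'
  have hℏ' : (ℏ : ℂ) ≠ 0 := by exact_mod_cast hℏ.ne'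
  unfold wignerF
  rw [(hasDerivAt_pow_mul_genLaguerre_mul_exp ℏ m (n - m) _ hzq hrq).deriv,
    (hasDerivAt_pow_mul_genLaguerre_mul_exp ℏ m (n - m) _ hzp hrp).deriv,
    Nat.sub_add_comm hmn]
  generalize (√((m.factorial : ℝ) / (n.factorial : ℝ)) : ℂ) = A at *
  generalize (√((m.factorial : ℝ) / ((n + 1).factorial : ℝ)) : ℂ) = B at *
  generalize (√(((n : ℝ) + 1) * ℏ) : ℂ) = D at *
  generalize (√(2 / ℏ) : ℂ) = S at *
  generalize ((genLaguerre m (n - m) (2 * (q ^ 2 + p ^ 2) / ℏ) : ℝ) : ℂ) = L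
  generalize ((genLaguerre m (n - m + 1) (2 * (q ^ 2 + p ^ 2) / ℏ) : ℝ) : ℂ) = L'
  generalize (Real.exp (-(q ^ 2 + p ^ 2) / ℏ) : ℂ) = E
  generalize (√2 : ℂ) = R at *
  generalize n - m = k
  push_cast
  have hI : Complex.I ^ 2 = -1 := Complex.I_sq
  trans 2 * (-1) ^ m * (R * A) * S ^ k * ((q : ℂ) + Complex.I * p) ^ (k + 1) * L' * E
  · generalize ((q : ℂ) + Complex.I * p) ^ (k - 1) = Y
    rw [pow_succ ((q : ℂ) + Complex.I * p) k]
    generalize ((q : ℂ) + Complex.I * p) ^ k = Z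
    field_simp
    linear_combination (2 * A * S ^ k * E * Z * q * (L - 2 * L')) * hI
      - 2 * A * S ^ k * E * Z * (q + Complex.I * p) * L' * hsq
  · rw [← hconst]
    ring
end

section
/- For all m, n ∈ ℕ with n ≥ m + 1, the right Moyal star product of the Wigner eigenfunction f_{m,n} with the creation symbol ā satisfies f_{m,n} ⋆ ā = √(nħ) f_{m,n−1}, where for the linear function ā the star product is exactly f ⋆ ā = f·ā + (iħ/2)(∂_q f ∂_π ā − ∂_π f ∂_q ā). -/
open Complex Real

theorem differentiable_genLaguerre (m α : ℕ) : Differentiable ℝ (genLaguerre m α) := by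
  unfold genLaguerre
  fun_prop

/-- Lowering of the order: `(α + x d/dx) L_m^α = (m + α) L_m^{α-1}`, with `α = b + 1`. -/
theorem genLaguerre_succ_add_mul_deriv (m b : ℕ) (x : ℝ) :
    ((b : ℝ) + 1) * genLaguerre m (b + 1) x + x * deriv (genLaguerre m (b + 1)) x
      = ((m : ℝ) + b + 1) * genLaguerre m b x := by
  have hderiv : HasDerivAt (genLaguerre m (b + 1))
      (∑ k ∈ Finset.range (m + 1),
        (Real.Gamma ((m : ℝ) + (b + 1 : ℕ) + 1) / Real.Gamma ((k : ℝ) + (b + 1 : ℕ) + 1)) *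
          ((k : ℝ) * (-x) ^ (k - 1) * (-1)) / ((k.factorial : ℝ) * ((m - k).factorial : ℝ))) x :=
    HasDerivAt.fun_sum fun k _ =>
      ((((hasDerivAt_id x).neg).pow k).const_mul _).div_const _
  rw [hderiv.deriv]
  unfold genLaguerre
  simp only [Finset.mul_sum]
  rw [← Finset.sum_add_distrib]
  refine Finset.sum_congr rfl fun k _ => ?_
  have hpow : x * ((k : ℝ) * (-x) ^ (k - 1) * (-1)) = k * (-x) ^ k := by
    cases k with
    | zero => simp
    | succ j => rw [Nat.add_sub_cancel, pow_succ]; ring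
  have hm : Real.Gamma ((m : ℝ) + (b + 1 : ℕ) + 1)
      = ((m : ℝ) + b + 1) * Real.Gamma ((m : ℝ) + b + 1) := by
    rw [← Real.Gamma_add_one (by positivity)]
    congr 1; push_cast; ring
  have hk : Real.Gamma ((k : ℝ) + (b + 1 : ℕ) + 1)
      = ((k : ℝ) + b + 1) * Real.Gamma ((k : ℝ) + b + 1) := by
    rw [← Real.Gamma_add_one (by positivity)]
    congr 1; push_cast; ring
  have hΓ : Real.Gamma ((k : ℝ) + b + 1) ≠ 0 := (Real.Gamma_pos_of_pos (by positivity)).ne'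
  have hk0 : (k : ℝ) + b + 1 ≠ 0 := by positivity
  rw [← mul_div_assoc x, mul_left_comm x, hpow, hm, hk]
  field_simp
  ring

/-- Derivative along a curve `z(t)` in phase space, of squared radius `r(t)`, of a function of
the form taken by the Wigner eigenfunctions. -/
theorem hasDerivAt_pow_mul_comp_mul_exp {z : ℝ → ℂ} {r : ℝ → ℝ} {L : ℝ → ℝ} {z' : ℂ} {r' t : ℝ}
    (ℏ : ℝ) (C : ℂ) (a : ℕ) (hz : HasDerivAt z z' t) (hr : HasDerivAt r r' t)
    (hL : Differentiable ℝ L) :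
    HasDerivAt (fun s => C * z s ^ a * (L (2 * r s / ℏ) : ℂ) * (Real.exp (-r s / ℏ) : ℂ))
      (C * (Real.exp (-r t / ℏ) : ℂ) * (a * z t ^ (a - 1) * z' * (L (2 * r t / ℏ) : ℂ)
        + z t ^ a * (((deriv L (2 * r t / ℏ) : ℝ) : ℂ) * (2 * r' / ℏ)
          - (L (2 * r t / ℏ) : ℂ) * (r' / ℏ)))) t := by
  have hLr := ((hL (2 * r t / ℏ)).hasDerivAt.comp t ((hr.const_mul 2).div_const ℏ)).ofReal_comp
  have hexp := ((hr.neg.div_const ℏ).exp).ofReal_comp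
  refine ((((hz.pow a).const_mul C).mul hLr).mul hexp).congr_deriv ?_
  simp only [Function.comp_apply, Pi.neg_apply, Pi.pow_apply, Pi.mul_apply]
  push_cast
  ring

/-- for `n ≥ m+1`, the right Moyal star product of `f_{m,n}` with the
creation symbol `ā = (q−ip)/√2` (which for linear `ā` is exactly
`f ⋆ ā = f·ā + (iℏ/2)(∂_q f ∂_p ā − ∂_p f ∂_q ā)`, with `∂_q ā = 1/√2`, `∂_p ā = −i/√2`)
satisfies `f_{m,n} ⋆ ā = √(nℏ) f_{m,n−1}`. -/
theorem wigner_star_creation (ℏ : ℝ) (hℏ : 0 < ℏ) (m n : ℕ) (hmn : m + 1 ≤ n)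
    (q p : ℝ) :
    wignerF ℏ m n q p * (((q : ℂ) - Complex.I * (p : ℂ)) / (Real.sqrt 2 : ℂ))
      + (Complex.I * (ℏ : ℂ) / 2) *
        (deriv (fun t : ℝ => wignerF ℏ m n t p) q * (-(Complex.I) / (Real.sqrt 2 : ℂ))
          - deriv (fun t : ℝ => wignerF ℏ m n q t) p * (1 / (Real.sqrt 2 : ℂ)))
      = (Real.sqrt ((n : ℝ) * ℏ) : ℂ) * wignerF ℏ m (n - 1) q p := by
  obtain ⟨b, rfl⟩ := Nat.exists_eq_add_of_le hmn
  have hsub : m + 1 + b - m = b + 1 := by omega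
  have hsub' : m + 1 + b - 1 = m + b := by omega
  have hsub'' : m + b - m = b := by omega
  have hL := differentiable_genLaguerre m (b + 1)
  have hzq : HasDerivAt (fun t : ℝ => (t : ℂ) + I * (p : ℂ)) 1 q :=
    (hasDerivAt_id q).ofReal_comp.add_const _
  have hzp : HasDerivAt (fun t : ℝ => (q : ℂ) + I * (t : ℂ)) I p := by
    simpa using ((hasDerivAt_id p).ofReal_comp.const_mul I).const_add (q : ℂ)
  have hrq : HasDerivAt (fun t : ℝ => t ^ 2 + p ^ 2) (2 * q) q := by
    simpa using (hasDerivAt_pow 2 q).add_const (p ^ 2)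
  have hrp : HasDerivAt (fun t : ℝ => q ^ 2 + t ^ 2) (2 * p) p := by
    simpa using (hasDerivAt_pow 2 p).const_add (q ^ 2)
  have hlag := congrArg (fun y : ℝ => (y : ℂ))
    (genLaguerre_succ_add_mul_deriv m b (2 * (q ^ 2 + p ^ 2) / ℏ))
  have hsqrt : √(m.factorial / (m + 1 + b).factorial : ℝ) * √(2 / ℏ) * ℏ * (m + b + 1)
      = √2 * √(((m + 1 + b : ℕ) : ℝ) * ℏ) * √(m.factorial / (m + b).factorial : ℝ) := by
    have hn : ((m + 1 + b).factorial : ℝ) = (m + b + 1) * (m + b).factorial := by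
      rw [show m + 1 + b = m + b + 1 by ring, Nat.factorial_succ]; push_cast; ring
    have hn0 : (0 : ℝ) ≤ m + b + 1 := by positivity
    rw [hn, ← Real.sqrt_mul (by positivity), ← Real.sqrt_mul (by positivity),
      ← Real.sqrt_mul (by positivity), mul_assoc, ← Real.sqrt_sq (mul_nonneg hℏ.le hn0),
      ← Real.sqrt_mul (by positivity)]
    congr 1
    push_cast
    field_simp
    ring
  have hsqrtC := congrArg (fun y : ℝ => (y : ℂ)) hsqrt
  have hℏ0 : (ℏ : ℂ) ≠ 0 := by exact_mod_cast hℏ.ne'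
  have h2 : (√2 : ℂ) ≠ 0 := by exact_mod_cast (Real.sqrt_pos.2 two_pos).ne'
  unfold wignerF
  rw [hsub, hsub', hsub'',
    (hasDerivAt_pow_mul_comp_mul_exp ℏ _ (b + 1) hzq hrq hL).deriv,
    (hasDerivAt_pow_mul_comp_mul_exp ℏ _ (b + 1) hzp hrp hL).deriv, Nat.add_sub_cancel]
  simp only [ofReal_mul, ofReal_add, ofReal_one, ofReal_natCast] at hlag hsqrtC
  rw [mul_assoc (√2 : ℂ), mul_comm (√2 : ℂ), ← div_eq_iff h2] at hsqrtC
  generalize (Real.exp (-(q ^ 2 + p ^ 2) / ℏ) : ℂ) = E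
  generalize (genLaguerre m (b + 1) (2 * (q ^ 2 + p ^ 2) / ℏ) : ℂ) = L at *
  generalize (genLaguerre m b (2 * (q ^ 2 + p ^ 2) / ℏ) : ℂ) = M at *
  generalize ((deriv (genLaguerre m (b + 1)) (2 * (q ^ 2 + p ^ 2) / ℏ) : ℝ) : ℂ) = D at *
  generalize (√(((m + 1 + b : ℕ) : ℝ) * ℏ) : ℂ) = N at *
  push_cast at hlag ⊢
  have hbracket : ((q : ℂ) + I * p) * L * (q - I * p) + I * ℏ / 2 *
      (((b + 1) * L + (q + I * p) * (D * (2 * (2 * q) / ℏ) - L * (2 * q / ℏ))) * (-I)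
        - ((b + 1) * I * L + (q + I * p) * (D * (2 * (2 * p) / ℏ) - L * (2 * p / ℏ))))
      = ℏ * ((b + 1) * L + 2 * (q ^ 2 + p ^ 2) / ℏ * D) := by
    field_simp
    linear_combination
      2 * (-ℏ * (b + 1) * L - (q + I * p) * q * (2 * D - L) - 2 * p ^ 2 * D) * I_sq
  generalize (√(m.factorial / (m + 1 + b).factorial : ℝ) : ℂ) = A at *
  generalize (√(m.factorial / (m + b).factorial : ℝ) : ℂ) = B at *
  generalize (√(2 / ℏ) : ℂ) = S at *
  generalize (q : ℂ) + I * p = z at *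
  linear_combination (2 * (-1) ^ m * A * S ^ (b + 1) * z ^ b * E / (√2 : ℂ)) * hbracket
    + (2 * (-1) ^ m * A * S ^ (b + 1) * z ^ b * E / (√2 : ℂ) * ℏ) * hlag
    + (2 * (-1) ^ m * S ^ b * z ^ b * M * E) * hsqrtC
end

section
/- For all m₁, m₂, n₁, n₂ ∈ ℕ with n₁ ≥ m₁ and n₂ ≥ m₂, the product state b^{(4)}_{m,n}(q¹,π¹,q²,π²) = f_{m₁,n₁}(q¹,π¹) f_{m₂,n₂}(q²,π²) satisfies H₀ ⋆ b^{(4)}_{m,n} = ħ(m₁ + m₂ + 1) b^{(4)}_{m,n}. -/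
open Complex Real

/-- Phase-space functions on ℝ⁴ with coordinates (q¹, π¹, q², π²). -/
abbrev PhaseFn := ℝ → ℝ → ℝ → ℝ → ℂ

/-- Partial derivative with respect to q¹. -/
noncomputable def pdQ1 (F : PhaseFn) : PhaseFn :=
  fun q1 p1 q2 p2 => deriv (fun t => F t p1 q2 p2) q1

/-- Partial derivative with respect to π¹. -/
noncomputable def pdP1 (F : PhaseFn) : PhaseFn :=
  fun q1 p1 q2 p2 => deriv (fun t => F q1 t q2 p2) p1

/-- Partial derivative with respect to q². -/
noncomputable def pdQ2 (F : PhaseFn) : PhaseFn :=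
  fun q1 p1 q2 p2 => deriv (fun t => F q1 p1 t p2) q2

/-- Partial derivative with respect to π². -/
noncomputable def pdP2 (F : PhaseFn) : PhaseFn :=
  fun q1 p1 q2 p2 => deriv (fun t => F q1 p1 q2 t) p2

/-- The family (∂_{q^l})_{l=1,2}. -/
noncomputable def dQ : Fin 2 → PhaseFn → PhaseFn := ![pdQ1, pdQ2]

/-- The family (∂_{π^l})_{l=1,2}. -/
noncomputable def dP : Fin 2 → PhaseFn → PhaseFn := ![pdP1, pdP2]

/-- First-order bidifferential operator
`P₁(f,g) = Σ_l (∂_{q^l} f ∂_{π^l} g − ∂_{π^l} f ∂_{q^l} g)`. -/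
noncomputable def P1 (F G : PhaseFn) : PhaseFn :=
  fun q1 p1 q2 p2 =>
    ∑ l : Fin 2,
      (dQ l F q1 p1 q2 p2 * dP l G q1 p1 q2 p2 -
        dP l F q1 p1 q2 p2 * dQ l G q1 p1 q2 p2)

/-- Second-order bidifferential operator
`P₂(f,g) = Σ_{l,l'} (∂_{q^l}∂_{q^{l'}} f ∂_{π^l}∂_{π^{l'}} g
  − 2 ∂_{q^l}∂_{π^{l'}} f ∂_{π^l}∂_{q^{l'}} g + ∂_{π^l}∂_{π^{l'}} f ∂_{q^l}∂_{q^{l'}} g)`. -/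
noncomputable def P2 (F G : PhaseFn) : PhaseFn :=
  fun q1 p1 q2 p2 =>
    ∑ l : Fin 2, ∑ l' : Fin 2,
      (dQ l (dQ l' F) q1 p1 q2 p2 * dP l (dP l' G) q1 p1 q2 p2 -
        2 * dQ l (dP l' F) q1 p1 q2 p2 * dP l (dQ l' G) q1 p1 q2 p2 +
        dP l (dP l' F) q1 p1 q2 p2 * dQ l (dQ l' G) q1 p1 q2 p2)

/-- Moyal star product, truncated (exactly) at second order:
valid when one factor is a polynomial of degree ≤ 2, in which case
`f ⋆ g = fg + (iℏ/2)P₁(f,g) + (1/2)(iℏ/2)² P₂(f,g)`. -/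
noncomputable def moyal (ℏ : ℝ) (F G : PhaseFn) : PhaseFn :=
  fun q1 p1 q2 p2 =>
    F q1 p1 q2 p2 * G q1 p1 q2 p2 +
      (Complex.I * (ℏ : ℂ) / 2) * P1 F G q1 p1 q2 p2 +
      (1 / 2) * (Complex.I * (ℏ : ℂ) / 2) ^ 2 * P2 F G q1 p1 q2 p2

/-- `H₀ = ½((q¹)² + (q²)² + (π¹)² + (π²)²)`. -/
noncomputable def H0 : PhaseFn :=
  fun q1 p1 q2 p2 => (((q1 ^ 2 + q2 ^ 2 + p1 ^ 2 + p2 ^ 2) / 2 : ℝ) : ℂ)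

/-- `H_L = −((Θ+Θ̄)/2ℏ)(q¹π² − q²π¹)`. -/
noncomputable def HL (ℏ Θ Θbar : ℝ) : PhaseFn :=
  fun q1 p1 q2 p2 => ((-((Θ + Θbar) / (2 * ℏ)) * (q1 * p2 - q2 * p1) : ℝ) : ℂ)

/-- `H_q = (Θ̄²/8ℏ²)((q¹)² + (q²)²)`. -/
noncomputable def Hq (ℏ Θbar : ℝ) : PhaseFn :=
  fun q1 p1 q2 p2 => ((Θbar ^ 2 / (8 * ℏ ^ 2) * (q1 ^ 2 + q2 ^ 2) : ℝ) : ℂ)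

/-- `H_π = (Θ²/8ℏ²)((π¹)² + (π²)²)`. -/
noncomputable def Hpi (ℏ Θ : ℝ) : PhaseFn :=
  fun q1 p1 q2 p2 => ((Θ ^ 2 / (8 * ℏ ^ 2) * (p1 ^ 2 + p2 ^ 2) : ℝ) : ℂ)

/-- Product state `b⁴_{m,n}(q¹,π¹,q²,π²) = f_{m₁,n₁}(q¹,π¹) f_{m₂,n₂}(q²,π²)`. -/
noncomputable def b4 (ℏ : ℝ) (m1 n1 m2 n2 : ℕ) : PhaseFn :=
  fun q1 p1 q2 p2 => wignerF ℏ m1 n1 q1 p1 * wignerF ℏ m2 n2 q2 p2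

/-- The generalized Laguerre polynomial `L_m^α` as an element of `ℝ[X]`. -/
noncomputable def laguerrePoly (m α : ℕ) : Polynomial ℝ :=
  ∑ k ∈ Finset.range (m + 1), Polynomial.monomial k
    (Real.Gamma ((m : ℝ) + α + 1) / Real.Gamma ((k : ℝ) + α + 1) * (-1) ^ k /
      ((k.factorial : ℝ) * ((m - k).factorial : ℝ)))

theorem eval_laguerrePoly (m α : ℕ) (x : ℝ) :
    (laguerrePoly m α).eval x = genLaguerre m α x := by
  simp only [laguerrePoly, genLaguerre, Polynomial.eval_finsetSum, Polynomial.eval_monomial]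
  refine Finset.sum_congr rfl fun k _ => ?_
  rw [neg_pow x k]
  ring

theorem coeff_laguerrePoly (m α k : ℕ) :
    (laguerrePoly m α).coeff k = if k ≤ m then
      Real.Gamma ((m : ℝ) + α + 1) / Real.Gamma ((k : ℝ) + α + 1) * (-1) ^ k /
        ((k.factorial : ℝ) * ((m - k).factorial : ℝ)) else 0 := by
  simp [laguerrePoly, Polynomial.finsetSum_coeff, Polynomial.coeff_monomial]

theorem coeff_succ_laguerrePoly (m α k : ℕ) :
    ((k : ℝ) + 1) * (k + α + 1) * (laguerrePoly m α).coeff (k + 1) =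
      ((k : ℝ) - m) * (laguerrePoly m α).coeff k := by
  rw [coeff_laguerrePoly, coeff_laguerrePoly]
  rcases lt_trichotomy k m with h | rfl | h
  · obtain ⟨d, rfl⟩ := Nat.exists_eq_add_of_lt h
    have hk : (k : ℝ) + α + 1 ≠ 0 := by positivity
    have hΓ : Real.Gamma ((k : ℝ) + α + 1) ≠ 0 :=
      (Real.Gamma_pos_of_pos (by positivity)).ne'
    rw [if_pos (by omega), if_pos (by omega), show k + d + 1 - (k + 1) = d by omega,
      show k + d + 1 - k = d + 1 by omega, Nat.factorial_succ, Nat.factorial_succ]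
    push_cast
    rw [show (k : ℝ) + 1 + α + 1 = (k + α + 1) + 1 by ring, Real.Gamma_add_one hk]
    have : (k.factorial : ℝ) ≠ 0 := by positivity
    have : (d.factorial : ℝ) ≠ 0 := by positivity
    field_simp
    ring
  · simp
  · rw [if_neg (by omega), if_neg (by omega)]
    simp

/-- Laguerre's differential equation. -/
theorem laguerrePoly_ode (m α : ℕ) :
    Polynomial.X * (laguerrePoly m α).derivative.derivative +
      (Polynomial.C ((α : ℝ) + 1) - Polynomial.X) * (laguerrePoly m α).derivative +
      Polynomial.C (m : ℝ) * laguerrePoly m α = 0 := by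
  ext k
  rw [sub_mul]
  have h := coeff_succ_laguerrePoly m α k
  cases k with
  | zero =>
    simp only [Polynomial.coeff_add, Polynomial.coeff_sub, Polynomial.coeff_C_mul,
      Polynomial.coeff_X_mul_zero, Polynomial.coeff_derivative, Polynomial.coeff_zero]
    push_cast at h ⊢
    linear_combination h
  | succ k =>
    simp only [Polynomial.coeff_add, Polynomial.coeff_sub, Polynomial.coeff_C_mul,
      Polynomial.coeff_X_mul, Polynomial.coeff_derivative, Polynomial.coeff_zero]
    push_cast at h ⊢
    linear_combination h

/-- The derivative of `r ↦ L(2r/ℏ) e^{-r/ℏ}` for a polynomial `L`. -/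
theorem hasDerivAt_eval_mul_exp (ℏ : ℝ) (L : Polynomial ℝ) (r : ℝ) :
    HasDerivAt (fun r : ℝ => L.eval (2 * r / ℏ) * Real.exp (-r / ℏ))
      (((Polynomial.C (2 / ℏ) * L.derivative - Polynomial.C (1 / ℏ) * L).eval (2 * r / ℏ)) *
        Real.exp (-r / ℏ)) r := by
  have h1 : HasDerivAt (fun r : ℝ => 2 * r / ℏ) (2 / ℏ) r := by
    simpa using ((hasDerivAt_id r).const_mul 2).div_const ℏ
  have h2 : HasDerivAt (fun r : ℝ => -r / ℏ) (-1 / ℏ) r :=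
    (hasDerivAt_id r).neg.div_const ℏ
  refine (((L.hasDerivAt _).comp r h1).mul h2.exp).congr_deriv ?_
  simp
  ring

/-- The radial factor of the Wigner eigenfunctions solves the radial oscillator equation. -/
theorem exists_radial_derivatives (ℏ : ℝ) (hℏ : 0 < ℏ) (m α : ℕ) :
    ∃ u' u'' : ℝ → ℝ,
      (∀ r, HasDerivAt (fun r : ℝ => genLaguerre m α (2 * r / ℏ) * Real.exp (-r / ℏ)) (u' r) r) ∧
      (∀ r, HasDerivAt u' (u'' r) r) ∧
      ∀ r, r / 2 * (genLaguerre m α (2 * r / ℏ) * Real.exp (-r / ℏ)) -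
          ℏ ^ 2 / 2 * ((α + 1) * u' r + r * u'' r) =
        ℏ * (m + α / 2 + 1 / 2) * (genLaguerre m α (2 * r / ℏ) * Real.exp (-r / ℏ)) := by
  simp only [← eval_laguerrePoly]
  refine ⟨_, _, fun r => hasDerivAt_eval_mul_exp ℏ _ r,
    fun r => hasDerivAt_eval_mul_exp ℏ _ r, fun r => ?_⟩
  have h := congrArg (Polynomial.eval (2 * r / ℏ)) (laguerrePoly_ode m α)
  simp only [Polynomial.eval_add, Polynomial.eval_sub, Polynomial.eval_mul, Polynomial.eval_C,
    Polynomial.eval_X, Polynomial.eval_zero, Polynomial.derivative_sub,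
    Polynomial.derivative_C_mul] at h ⊢
  field_simp at h ⊢
  linear_combination -2 * h

/-- `q + iπ` has derivative `1` in `q`. -/
theorem hasDerivAt_ofReal_add (q : ℝ) (c : ℂ) : HasDerivAt (fun t : ℝ => (t : ℂ) + c) 1 q :=
  (Complex.ofRealCLM.hasDerivAt (x := q)).add_const c

/-- `q + iπ` has derivative `i` in `π`. -/
theorem hasDerivAt_add_I_mul_ofReal (p : ℝ) (c : ℂ) :
    HasDerivAt (fun t : ℝ => c + Complex.I * (t : ℂ)) Complex.I p := by
  simpa using ((Complex.ofRealCLM.hasDerivAt (x := p)).const_mul Complex.I).const_add c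

/-- The derivative along a line of `w(ζ(t)) u(s(t))`, where `ζ` is affine with
slope `c` and `s` has derivative `2t`. -/
theorem hasDerivAt_holomorphic_mul_radial {w w' : ℂ → ℂ} {u u' : ℝ → ℝ}
    (hw : ∀ z, HasDerivAt w (w' z) z) (hu : ∀ r, HasDerivAt u (u' r) r)
    {ζ : ℝ → ℂ} {c : ℂ} {s : ℝ → ℝ} {t : ℝ} (hζ : HasDerivAt ζ c t)
    (hs : HasDerivAt s (2 * t) t) :
    HasDerivAt (fun t => w (ζ t) * (u (s t) : ℂ))
      (c * w' (ζ t) * (u (s t) : ℂ) + 2 * (t : ℂ) * (w (ζ t) * (u' (s t) : ℂ))) t := by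
  have h1 := (hw (ζ t)).comp t hζ
  have h2 := ((hu (s t)).comp t hs).ofReal_comp
  refine (h1.mul h2).congr_deriv ?_
  simp only [Function.comp_apply]
  push_cast
  ring

/-- The second derivative along a line of `w(ζ(t)) u(s(t))`, where `ζ` is affine with slope `c`
and `s` has derivative `2t`. -/
theorem hasDerivAt_deriv_holomorphic_mul_radial {w w' w'' : ℂ → ℂ} {u u' u'' : ℝ → ℝ}
    (hw : ∀ z, HasDerivAt w (w' z) z) (hw' : ∀ z, HasDerivAt w' (w'' z) z)
    (hu : ∀ r, HasDerivAt u (u' r) r) (hu' : ∀ r, HasDerivAt u' (u'' r) r)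
    {ζ : ℝ → ℂ} {c : ℂ} {s : ℝ → ℝ} {t : ℝ} (hζ : HasDerivAt ζ c t)
    (hs : HasDerivAt s (2 * t) t) :
    HasDerivAt (fun t => c * w' (ζ t) * (u (s t) : ℂ) + 2 * (t : ℂ) * (w (ζ t) * (u' (s t) : ℂ)))
      (c ^ 2 * w'' (ζ t) * (u (s t) : ℂ) + 4 * (t : ℂ) * c * (w' (ζ t) * (u' (s t) : ℂ)) +
        2 * (w (ζ t) * (u' (s t) : ℂ)) + 4 * (t : ℂ) ^ 2 * (w (ζ t) * (u'' (s t) : ℂ))) t := by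
  have h1 := (hasDerivAt_holomorphic_mul_radial hw' hu hζ hs).const_mul c
  have h2 := hasDerivAt_holomorphic_mul_radial hw hu' hζ hs
  have h3 := (Complex.ofRealCLM.hasDerivAt (x := t)).const_mul (2 : ℂ)
  have h4 := h1.add (h3.mul h2)
  simp only [Complex.ofRealCLM_apply, Complex.ofReal_one] at h4
  refine (h4.congr_of_eventuallyEq (.of_forall fun x => ?_)).congr_deriv ?_
  · simp only [Pi.add_apply, Pi.mul_apply]
    ring
  · ring

/-- Derivatives of the Wigner eigenfunction, and the one-mode ⋆-eigenvalue equation. -/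
theorem exists_wignerF_derivatives (ℏ : ℝ) (hℏ : 0 < ℏ) (m n : ℕ) (hmn : m ≤ n) :
    ∃ fq fp fqq fpp : ℝ → ℝ → ℂ,
      (∀ q p, HasDerivAt (fun t => wignerF ℏ m n t p) (fq q p) q) ∧
      (∀ q p, HasDerivAt (fun t => wignerF ℏ m n q t) (fp q p) p) ∧
      (∀ q p, HasDerivAt (fun t => fq t p) (fqq q p) q) ∧
      (∀ q p, HasDerivAt (fun t => fp q t) (fpp q p) p) ∧
      ∀ q p : ℝ, ((q : ℂ) ^ 2 + (p : ℂ) ^ 2) / 2 * wignerF ℏ m n q p +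
          Complex.I * ℏ / 2 * (q * fp q p - p * fq q p) -
          (ℏ : ℂ) ^ 2 / 8 * (fqq q p + fpp q p) =
        ℏ * (m + 1 / 2) * wignerF ℏ m n q p := by
  obtain ⟨a, rfl⟩ := Nat.exists_eq_add_of_le hmn
  obtain ⟨u', u'', hu, hu', hode⟩ := exists_radial_derivatives ℏ hℏ m a
  set u : ℝ → ℝ := fun r => genLaguerre m a (2 * r / ℏ) * Real.exp (-r / ℏ) with hu_def
  obtain ⟨K, hK⟩ : ∃ K : ℂ, ∀ q p : ℝ, wignerF ℏ m (m + a) q p =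
      K * (((q : ℂ) + Complex.I * p) ^ a * (u (q ^ 2 + p ^ 2) : ℂ)) := by
    refine ⟨2 * (-1) ^ m * (Real.sqrt ((m.factorial : ℝ) / ((m + a).factorial : ℝ)) : ℂ) *
      ((Real.sqrt (2 / ℏ) : ℂ)) ^ a, fun q p => ?_⟩
    simp only [wignerF, Nat.add_sub_cancel_left, hu_def]
    push_cast
    ring
  have hw : ∀ z : ℂ, HasDerivAt (fun z : ℂ => z ^ a) (a * z ^ (a - 1)) z :=
    fun z => hasDerivAt_pow a z
  have hw' : ∀ z : ℂ, HasDerivAt (fun z : ℂ => a * z ^ (a - 1))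
      (a * (((a - 1 : ℕ) : ℂ) * z ^ (a - 1 - 1))) z :=
    fun z => (hasDerivAt_pow (a - 1) z).const_mul (a : ℂ)
  have hsq : ∀ t c : ℝ, HasDerivAt (fun t : ℝ => t ^ 2 + c) (2 * t) t := fun t c => by
    simpa using (hasDerivAt_pow 2 t).add_const c
  have hsp : ∀ t c : ℝ, HasDerivAt (fun t : ℝ => c + t ^ 2) (2 * t) t := fun t c => by
    simpa using (hasDerivAt_pow 2 t).const_add c
  simp only [hK]
  refine ⟨fun q p => _, fun q p => _, fun q p => _, fun q p => _,
    fun q p => (hasDerivAt_holomorphic_mul_radial hw hu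
      (hasDerivAt_ofReal_add q (Complex.I * p)) (hsq q (p ^ 2))).const_mul K,
    fun q p => (hasDerivAt_holomorphic_mul_radial hw hu
      (hasDerivAt_add_I_mul_ofReal p q) (hsp p (q ^ 2))).const_mul K,
    fun q p => (hasDerivAt_deriv_holomorphic_mul_radial hw hw' hu hu'
      (hasDerivAt_ofReal_add q (Complex.I * p)) (hsq q (p ^ 2))).const_mul K,
    fun q p => (hasDerivAt_deriv_holomorphic_mul_radial hw hw' hu hu'
      (hasDerivAt_add_I_mul_ofReal p q) (hsp p (q ^ 2))).const_mul K, fun q p => ?_⟩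
  have h := congrArg (fun x : ℝ => (x : ℂ)) (hode (q ^ 2 + p ^ 2))
  change ((_ * u (q ^ 2 + p ^ 2) - _ : ℝ) : ℂ) = ((_ * u (q ^ 2 + p ^ 2) : ℝ) : ℂ) at h
  push_cast at h
  have hz : (a : ℂ) * ((q : ℂ) + Complex.I * p) ^ (a - 1) * ((q : ℂ) + Complex.I * p) =
      a * ((q : ℂ) + Complex.I * p) ^ a := by
    rcases a with _ | a
    · simp
    · rw [Nat.add_sub_cancel, pow_succ]
      ring
  beta_reduce
  generalize ((q : ℂ) + Complex.I * p) ^ (a - 1 - 1) = w₂ at *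
  generalize ((q : ℂ) + Complex.I * p) ^ (a - 1) = w₁ at *
  generalize ((q : ℂ) + Complex.I * p) ^ a = w₀ at *
  generalize (u (q ^ 2 + p ^ 2) : ℂ) = u₀ at *
  generalize (u' (q ^ 2 + p ^ 2) : ℂ) = u₁ at *
  generalize (u'' (q ^ 2 + p ^ 2) : ℂ) = u₂ at *
  have hI : Complex.I ^ 2 = -1 := Complex.I_sq
  linear_combination (K * w₀) * h - K * (ℏ * u₀ / 2 + ℏ ^ 2 / 2 * u₁) * hz +
    K * (ℏ / 2 * q * a * w₁ * u₀ - ℏ ^ 2 / 8 * (a * (((a - 1 : ℕ) : ℂ) * w₂)) * u₀) * hI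

theorem pdQ1_H0 : pdQ1 H0 = fun (q1 : ℝ) _ _ _ => (q1 : ℂ) := by
  funext q1 p1 q2 p2
  refine HasDerivAt.deriv (HasDerivAt.ofReal_comp ?_)
  exact (((((hasDerivAt_pow 2 q1).add_const _).add_const _).add_const _).div_const 2).congr_deriv
    (by simp)

theorem pdP1_H0 : pdP1 H0 = fun _ (p1 : ℝ) _ _ => (p1 : ℂ) := by
  funext q1 p1 q2 p2
  refine HasDerivAt.deriv (HasDerivAt.ofReal_comp ?_)
  exact ((((hasDerivAt_pow 2 p1).const_add _).add_const _).div_const 2).congr_deriv (by simp)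

theorem pdQ2_H0 : pdQ2 H0 = fun _ _ (q2 : ℝ) _ => (q2 : ℂ) := by
  funext q1 p1 q2 p2
  refine HasDerivAt.deriv (HasDerivAt.ofReal_comp ?_)
  exact (((((hasDerivAt_pow 2 q2).const_add _).add_const _).add_const _).div_const 2).congr_deriv
    (by simp)

theorem pdP2_H0 : pdP2 H0 = fun _ _ _ (p2 : ℝ) => (p2 : ℂ) := by
  funext q1 p1 q2 p2
  refine HasDerivAt.deriv (HasDerivAt.ofReal_comp ?_)
  exact (((hasDerivAt_pow 2 p2).const_add _).div_const 2).congr_deriv (by simp)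

theorem deriv_ofReal_id (x : ℝ) : deriv (fun t : ℝ => (t : ℂ)) x = 1 :=
  (Complex.ofRealCLM.hasDerivAt (x := x)).deriv

/-- The star product with `H₀` as a second-order differential operator. -/
theorem moyal_H0 (ℏ : ℝ) (G : PhaseFn) (q1 p1 q2 p2 : ℝ) :
    moyal ℏ H0 G q1 p1 q2 p2 =
      ((q1 : ℂ) ^ 2 + (q2 : ℂ) ^ 2 + (p1 : ℂ) ^ 2 + (p2 : ℂ) ^ 2) / 2 * G q1 p1 q2 p2 +
      Complex.I * ℏ / 2 * (q1 * pdP1 G q1 p1 q2 p2 - p1 * pdQ1 G q1 p1 q2 p2 +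
        q2 * pdP2 G q1 p1 q2 p2 - p2 * pdQ2 G q1 p1 q2 p2) -
      (ℏ : ℂ) ^ 2 / 8 * (pdQ1 (pdQ1 G) q1 p1 q2 p2 + pdP1 (pdP1 G) q1 p1 q2 p2 +
        pdQ2 (pdQ2 G) q1 p1 q2 p2 + pdP2 (pdP2 G) q1 p1 q2 p2) := by
  simp only [moyal, P1, P2, dQ, dP, Fin.sum_univ_two, Matrix.cons_val_zero, Matrix.cons_val_one,
    pdQ1_H0, pdP1_H0, pdQ2_H0, pdP2_H0]
  rw [show H0 q1 p1 q2 p2 =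
    ((q1 : ℂ) ^ 2 + (q2 : ℂ) ^ 2 + (p1 : ℂ) ^ 2 + (p2 : ℂ) ^ 2) / 2 by simp [H0]]
  generalize pdQ1 (pdQ1 G) q1 p1 q2 p2 = Gqq₁
  generalize pdP1 (pdP1 G) q1 p1 q2 p2 = Gpp₁
  generalize pdQ2 (pdQ2 G) q1 p1 q2 p2 = Gqq₂
  generalize pdP2 (pdP2 G) q1 p1 q2 p2 = Gpp₂
  simp only [pdQ1, pdP1, pdQ2, pdP2, deriv_const, deriv_ofReal_id]
  linear_combination (ℏ : ℂ) ^ 2 / 8 * (Gqq₁ + Gpp₁ + Gqq₂ + Gpp₂) * Complex.I_sq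

/-- `H₀ ⋆ b⁴_{m,n} = ℏ(m₁ + m₂ + 1) b⁴_{m,n}` for n₁ ≥ m₁, n₂ ≥ m₂. -/
theorem H0_star_b4 (ℏ : ℝ) (hℏ : 0 < ℏ) (m1 m2 n1 n2 : ℕ)
    (h1 : m1 ≤ n1) (h2 : m2 ≤ n2) :
    moyal ℏ H0 (b4 ℏ m1 n1 m2 n2) =
      fun q1 p1 q2 p2 =>
        ((ℏ : ℂ) * ((m1 : ℂ) + (m2 : ℂ) + 1)) * b4 ℏ m1 n1 m2 n2 q1 p1 q2 p2 := by
  obtain ⟨fq, fp, fqq, fpp, hfq, hfp, hfqq, hfpp, hf⟩ := exists_wignerF_derivatives ℏ hℏ m1 n1 h1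
  obtain ⟨gq, gp, gqq, gpp, hgq, hgp, hgqq, hgpp, hg⟩ := exists_wignerF_derivatives ℏ hℏ m2 n2 h2
  have hQ1 : pdQ1 (b4 ℏ m1 n1 m2 n2) = fun q1 p1 q2 p2 => fq q1 p1 * wignerF ℏ m2 n2 q2 p2 := by
    funext q1 p1 q2 p2
    exact ((hfq q1 p1).mul_const _).deriv
  have hP1 : pdP1 (b4 ℏ m1 n1 m2 n2) = fun q1 p1 q2 p2 => fp q1 p1 * wignerF ℏ m2 n2 q2 p2 := by
    funext q1 p1 q2 p2
    exact ((hfp q1 p1).mul_const _).deriv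
  have hQ2 : pdQ2 (b4 ℏ m1 n1 m2 n2) = fun q1 p1 q2 p2 => wignerF ℏ m1 n1 q1 p1 * gq q2 p2 := by
    funext q1 p1 q2 p2
    exact ((hgq q2 p2).const_mul _).deriv
  have hP2 : pdP2 (b4 ℏ m1 n1 m2 n2) = fun q1 p1 q2 p2 => wignerF ℏ m1 n1 q1 p1 * gp q2 p2 := by
    funext q1 p1 q2 p2
    exact ((hgp q2 p2).const_mul _).deriv
  funext q1 p1 q2 p2
  rw [moyal_H0, hQ1, hP1, hQ2, hP2]
  simp only [pdQ1, pdP1, pdQ2, pdP2, ((hfqq q1 p1).mul_const _).deriv,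
    ((hfpp q1 p1).mul_const _).deriv, ((hgqq q2 p2).const_mul _).deriv,
    ((hgpp q2 p2).const_mul _).deriv, b4]
  linear_combination wignerF ℏ m2 n2 q2 p2 * hf q1 p1 + wignerF ℏ m1 n1 q1 p1 * hg q2 p2
end

section
/- The Hamiltonians H₀^♮ = (α²/2)((q¹)² + (q²)²) + (β²/2)((π¹)² + (π²)²) and H_L star-commute: [H₀^♮, H_L]_⋆ = H₀^♮ ⋆ H_L − H_L ⋆ H₀^♮ = 0 as a function on ℝ⁴, where α² = 1 + Θ̄²/(4ħ²) and β² = 1 + Θ²/(4ħ²). -/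
open Complex Real

/-- `H₀^♮ = (α²/2)((q¹)² + (q²)²) + (β²/2)((π¹)² + (π²)²)` with
`α² = 1 + Θ̄²/(4ℏ²)`, `β² = 1 + Θ²/(4ℏ²)`. -/
noncomputable def H0nat (ℏ Θ Θbar : ℝ) : PhaseFn :=
  fun q1 p1 q2 p2 =>
    (((1 + Θbar ^ 2 / (4 * ℏ ^ 2)) / 2 * (q1 ^ 2 + q2 ^ 2) +
        (1 + Θ ^ 2 / (4 * ℏ ^ 2)) / 2 * (p1 ^ 2 + p2 ^ 2) : ℝ) : ℂ)

theorem deriv_ofReal_quadratic {f : ℝ → ℝ} (a b c : ℝ) (hf : ∀ t, f t = a + b * t + c * t ^ 2)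
    (x : ℝ) : deriv (fun t => (f t : ℂ)) x = ((b + 2 * c * x : ℝ) : ℂ) := by
  have h := (((hasDerivAt_id' x).const_mul b).const_add a).add
    ((hasDerivAt_pow 2 x).const_mul c)
  have h : HasDerivAt f (b + 2 * c * x) x :=
    (h.congr_deriv (by norm_num; ring)).congr_of_eventuallyEq (.of_forall hf)
  exact h.ofReal_comp.deriv

theorem pdQ1_H0nat (ℏ Θ Θbar : ℝ) : pdQ1 (H0nat ℏ Θ Θbar) =
    fun q1 _ _ _ => (((1 + Θbar ^ 2 / (4 * ℏ ^ 2)) * q1 : ℝ) : ℂ) := by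
  funext q1 p1 q2 p2
  refine (deriv_ofReal_quadratic
    ((1 + Θbar ^ 2 / (4 * ℏ ^ 2)) / 2 * q2 ^ 2 + (1 + Θ ^ 2 / (4 * ℏ ^ 2)) / 2 * (p1 ^ 2 + p2 ^ 2))
    0 ((1 + Θbar ^ 2 / (4 * ℏ ^ 2)) / 2) (fun t => by ring) _).trans ?_
  congr 1
  ring

theorem pdP1_H0nat (ℏ Θ Θbar : ℝ) : pdP1 (H0nat ℏ Θ Θbar) =
    fun _ p1 _ _ => (((1 + Θ ^ 2 / (4 * ℏ ^ 2)) * p1 : ℝ) : ℂ) := by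
  funext q1 p1 q2 p2
  refine (deriv_ofReal_quadratic
    ((1 + Θ ^ 2 / (4 * ℏ ^ 2)) / 2 * p2 ^ 2 + (1 + Θbar ^ 2 / (4 * ℏ ^ 2)) / 2 * (q1 ^ 2 + q2 ^ 2))
    0 ((1 + Θ ^ 2 / (4 * ℏ ^ 2)) / 2) (fun t => by ring) _).trans ?_
  congr 1
  ring

theorem pdQ2_H0nat (ℏ Θ Θbar : ℝ) : pdQ2 (H0nat ℏ Θ Θbar) =
    fun _ _ q2 _ => (((1 + Θbar ^ 2 / (4 * ℏ ^ 2)) * q2 : ℝ) : ℂ) := by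
  funext q1 p1 q2 p2
  refine (deriv_ofReal_quadratic
    ((1 + Θbar ^ 2 / (4 * ℏ ^ 2)) / 2 * q1 ^ 2 + (1 + Θ ^ 2 / (4 * ℏ ^ 2)) / 2 * (p1 ^ 2 + p2 ^ 2))
    0 ((1 + Θbar ^ 2 / (4 * ℏ ^ 2)) / 2) (fun t => by ring) _).trans ?_
  congr 1
  ring

theorem pdP2_H0nat (ℏ Θ Θbar : ℝ) : pdP2 (H0nat ℏ Θ Θbar) =
    fun _ _ _ p2 => (((1 + Θ ^ 2 / (4 * ℏ ^ 2)) * p2 : ℝ) : ℂ) := by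
  funext q1 p1 q2 p2
  refine (deriv_ofReal_quadratic
    ((1 + Θ ^ 2 / (4 * ℏ ^ 2)) / 2 * p1 ^ 2 + (1 + Θbar ^ 2 / (4 * ℏ ^ 2)) / 2 * (q1 ^ 2 + q2 ^ 2))
    0 ((1 + Θ ^ 2 / (4 * ℏ ^ 2)) / 2) (fun t => by ring) _).trans ?_
  congr 1
  ring

theorem pdQ1_HL (ℏ Θ Θbar : ℝ) : pdQ1 (HL ℏ Θ Θbar) =
    fun _ _ _ p2 => ((-((Θ + Θbar) / (2 * ℏ)) * p2 : ℝ) : ℂ) := by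
  funext q1 p1 q2 p2
  refine (deriv_ofReal_quadratic (-((Θ + Θbar) / (2 * ℏ)) * (-(q2 * p1)))
    (-((Θ + Θbar) / (2 * ℏ)) * p2) 0 (fun t => by ring) _).trans ?_
  congr 1
  ring

theorem pdP1_HL (ℏ Θ Θbar : ℝ) : pdP1 (HL ℏ Θ Θbar) =
    fun _ _ q2 _ => ((-((Θ + Θbar) / (2 * ℏ)) * -q2 : ℝ) : ℂ) := by
  funext q1 p1 q2 p2
  refine (deriv_ofReal_quadratic (-((Θ + Θbar) / (2 * ℏ)) * (q1 * p2))
    (-((Θ + Θbar) / (2 * ℏ)) * (-q2)) 0 (fun t => by ring) _).trans ?_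
  congr 1
  ring

theorem pdQ2_HL (ℏ Θ Θbar : ℝ) : pdQ2 (HL ℏ Θ Θbar) =
    fun _ p1 _ _ => ((-((Θ + Θbar) / (2 * ℏ)) * -p1 : ℝ) : ℂ) := by
  funext q1 p1 q2 p2
  refine (deriv_ofReal_quadratic (-((Θ + Θbar) / (2 * ℏ)) * (q1 * p2))
    (-((Θ + Θbar) / (2 * ℏ)) * (-p1)) 0 (fun t => by ring) _).trans ?_
  congr 1
  ring

theorem pdP2_HL (ℏ Θ Θbar : ℝ) : pdP2 (HL ℏ Θ Θbar) =
    fun q1 _ _ _ => ((-((Θ + Θbar) / (2 * ℏ)) * q1 : ℝ) : ℂ) := by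
  funext q1 p1 q2 p2
  refine (deriv_ofReal_quadratic (-((Θ + Θbar) / (2 * ℏ)) * (-(q2 * p1)))
    (-((Θ + Θbar) / (2 * ℏ)) * q1) 0 (fun t => by ring) _).trans ?_
  congr 1
  ring

/-- `[H₀^♮, H_L]_⋆ = H₀^♮ ⋆ H_L − H_L ⋆ H₀^♮ = 0` as a function on ℝ⁴. -/
theorem H0nat_HL_star_commute (ℏ Θ Θbar : ℝ) (hℏ : 0 < ℏ) :
    (fun q1 p1 q2 p2 =>
        moyal ℏ (H0nat ℏ Θ Θbar) (HL ℏ Θ Θbar) q1 p1 q2 p2 -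
          moyal ℏ (HL ℏ Θ Θbar) (H0nat ℏ Θ Θbar) q1 p1 q2 p2) =
      fun (_ _ _ _ : ℝ) => (0 : ℂ) := by
  have lin (a x : ℝ) : deriv (fun t : ℝ => ((a * t : ℝ) : ℂ)) x = (a : ℂ) :=
    (deriv_ofReal_quadratic 0 a 0 (fun t => by ring) x).trans (by simp)
  funext q1 p1 q2 p2
  simp only [moyal, P1, P2, dQ, dP, Fin.sum_univ_two, Matrix.cons_val_zero, Matrix.cons_val_one,
    pdQ1_H0nat, pdP1_H0nat, pdQ2_H0nat, pdP2_H0nat, pdQ1_HL, pdP1_HL, pdQ2_HL, pdP2_HL]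
  simp only [pdQ1, pdP1, pdQ2, pdP2, lin, deriv_const]
  push_cast
  ring
end

section
/- The star commutator of H₀ and H_I = H_q + H_π is the phase-space-dependent function [H₀, H_I]_⋆ = H₀ ⋆ H_I − H_I ⋆ H₀ = i((Θ² − Θ̄²)/4ħ)(q¹π¹ + q²π²). -/
open Complex Real

/-- Mixed position and momentum derivatives of `F` commute. -/
def MixedPartialsCommute (F : PhaseFn) : Prop :=
  ∀ l l' : Fin 2, dQ l (dP l' F) = dP l' (dQ l F)

theorem P1_antisymm (F G : PhaseFn) (q1 p1 q2 p2 : ℝ) :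
    P1 G F q1 p1 q2 p2 = -P1 F G q1 p1 q2 p2 := by
  simp only [P1, Fin.sum_univ_two]
  ring

theorem P2_symm {F G : PhaseFn} (hF : MixedPartialsCommute F) (hG : MixedPartialsCommute G)
    (q1 p1 q2 p2 : ℝ) : P2 G F q1 p1 q2 p2 = P2 F G q1 p1 q2 p2 := by
  simp only [P2, Fin.sum_univ_two, hF _ _, hG _ _]
  ring

theorem moyal_sub_moyal_swap (ℏ : ℝ) {F G : PhaseFn} (hF : MixedPartialsCommute F)
    (hG : MixedPartialsCommute G) (q1 p1 q2 p2 : ℝ) :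
    moyal ℏ F G q1 p1 q2 p2 - moyal ℏ G F q1 p1 q2 p2 =
      Complex.I * (ℏ : ℂ) * P1 F G q1 p1 q2 p2 := by
  simp only [moyal, P2_symm hF hG, P1_antisymm F G]
  ring

/-- The quadratic form `a ((q¹)² + (q²)²) + b ((π¹)² + (π²)²)`. -/
noncomputable def isotropicForm (a b : ℂ) : PhaseFn :=
  fun q1 p1 q2 p2 => a * ((q1 : ℂ) ^ 2 + (q2 : ℂ) ^ 2) + b * ((p1 : ℂ) ^ 2 + (p2 : ℂ) ^ 2)

theorem deriv_eq_of_eq_mul_sq_add {f : ℝ → ℂ} (a c : ℂ) (hf : ∀ t : ℝ, f t = a * (t : ℂ) ^ 2 + c)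
    (x : ℝ) : deriv f x = 2 * a * x := by
  have h : HasDerivAt (fun t : ℝ => a * (t : ℂ) ^ 2 + c) (a * (2 * (x : ℂ) ^ 1 * 1)) x := by
    simpa using (((hasDerivAt_id x).ofReal_comp.pow 2).const_mul a).add_const c
  rw [funext hf, h.deriv]
  ring

theorem dQ_zero_isotropicForm (a b : ℂ) :
    dQ 0 (isotropicForm a b) = fun (q1 : ℝ) _ _ _ => 2 * a * q1 := by
  funext q1 p1 q2 p2
  exact deriv_eq_of_eq_mul_sq_add a (a * (q2 : ℂ) ^ 2 + b * ((p1 : ℂ) ^ 2 + (p2 : ℂ) ^ 2))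
    (fun t => by simp only [isotropicForm]; ring) q1

theorem dQ_one_isotropicForm (a b : ℂ) :
    dQ 1 (isotropicForm a b) = fun _ _ (q2 : ℝ) _ => 2 * a * q2 := by
  funext q1 p1 q2 p2
  exact deriv_eq_of_eq_mul_sq_add a (a * (q1 : ℂ) ^ 2 + b * ((p1 : ℂ) ^ 2 + (p2 : ℂ) ^ 2))
    (fun t => by simp only [isotropicForm]; ring) q2

theorem dP_zero_isotropicForm (a b : ℂ) :
    dP 0 (isotropicForm a b) = fun _ (p1 : ℝ) _ _ => 2 * b * p1 := by
  funext q1 p1 q2 p2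
  exact deriv_eq_of_eq_mul_sq_add b (b * (p2 : ℂ) ^ 2 + a * ((q1 : ℂ) ^ 2 + (q2 : ℂ) ^ 2))
    (fun t => by simp only [isotropicForm]; ring) p1

theorem dP_one_isotropicForm (a b : ℂ) :
    dP 1 (isotropicForm a b) = fun _ _ _ (p2 : ℝ) => 2 * b * p2 := by
  funext q1 p1 q2 p2
  exact deriv_eq_of_eq_mul_sq_add b (b * (p1 : ℂ) ^ 2 + a * ((q1 : ℂ) ^ 2 + (q2 : ℂ) ^ 2))
    (fun t => by simp only [isotropicForm]; ring) p2

theorem mixedPartialsCommute_isotropicForm (a b : ℂ) :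
    MixedPartialsCommute (isotropicForm a b) := by
  intro l l'
  fin_cases l <;> fin_cases l' <;>
    simp only [Fin.zero_eta, Fin.mk_one, dQ_zero_isotropicForm, dQ_one_isotropicForm,
      dP_zero_isotropicForm, dP_one_isotropicForm] <;>
    funext q1 p1 q2 p2 <;>
    simp [dQ, dP, pdQ1, pdQ2, pdP1, pdP2]

theorem P1_isotropicForm (a b c d : ℂ) (q1 p1 q2 p2 : ℝ) :
    P1 (isotropicForm a b) (isotropicForm c d) q1 p1 q2 p2 =
      4 * (a * d - b * c) * ((q1 : ℂ) * p1 + q2 * p2) := by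
  simp only [P1, Fin.sum_univ_two, dQ_zero_isotropicForm, dQ_one_isotropicForm,
    dP_zero_isotropicForm, dP_one_isotropicForm]
  ring

theorem H0_eq_isotropicForm : H0 = isotropicForm (1 / 2) (1 / 2) := by
  funext q1 p1 q2 p2
  simp only [H0, isotropicForm]
  push_cast
  ring

theorem Hq_add_Hpi_eq_isotropicForm (ℏ Θ Θbar : ℝ) :
    (fun a b c d => Hq ℏ Θbar a b c d + Hpi ℏ Θ a b c d) =
      isotropicForm ((Θbar : ℂ) ^ 2 / (8 * (ℏ : ℂ) ^ 2)) ((Θ : ℂ) ^ 2 / (8 * (ℏ : ℂ) ^ 2)) := by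
  funext q1 p1 q2 p2
  simp only [Hq, Hpi, isotropicForm]
  push_cast
  ring

/-- `[H₀, H_I]_⋆ = H₀ ⋆ H_I − H_I ⋆ H₀ = i((Θ² − Θ̄²)/4ℏ)(q¹π¹ + q²π²)`,
where `H_I = H_q + H_π`. -/
theorem H0_HI_star_commutator (ℏ Θ Θbar : ℝ) (hℏ : 0 < ℏ) :
    (fun q1 p1 q2 p2 =>
        moyal ℏ H0 (fun a b c d => Hq ℏ Θbar a b c d + Hpi ℏ Θ a b c d) q1 p1 q2 p2 -
          moyal ℏ (fun a b c d => Hq ℏ Θbar a b c d + Hpi ℏ Θ a b c d) H0 q1 p1 q2 p2) =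
      fun q1 p1 q2 p2 =>
        Complex.I * (((Θ ^ 2 - Θbar ^ 2) / (4 * ℏ) : ℝ) : ℂ) *
          (((q1 * p1 + q2 * p2 : ℝ)) : ℂ) := by
  have hne : (ℏ : ℂ) ≠ 0 := Complex.ofReal_ne_zero.mpr hℏ.ne'
  funext q1 p1 q2 p2
  rw [Hq_add_Hpi_eq_isotropicForm, H0_eq_isotropicForm,
    moyal_sub_moyal_swap ℏ (mixedPartialsCommute_isotropicForm _ _)
      (mixedPartialsCommute_isotropicForm _ _), P1_isotropicForm]
  push_cast
  field_simp
  ring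
end
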